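/- Arcones' inequality for Hermite rank 1 in dimension 1: let (W, Q) be a centered Gaussian vector in ℝ² with E[W²] = E[Q²] = 1 and r = E[WQ], and let h : ℝ → ℝ satisfy E[h(W)²] < ∞ and E[h(W)] = 0. Then |E[h(W)h(Q)]| ≤ |r| · E[h(W)²] provided h has Hermite rank at least 1 (i.e., E[h(W)] = 0 is automatic rank ≥ 1 here strengthened: if additionally E[h(W)W] may be nonzero, rank is 1). Concretely: if E[h(W)] = 0, then |Cov(h(W), h(Q))| ≤ |r| E[h(W)²]. -/

import Mathlib

open MeasureTheory ProbabilityTheory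

namespace Arcones

/-- The algebraic core: positivity of the power series coefficients. -/
lemma core (s : Finset ℝ) (d : ℝ → ℝ) (r : ℝ) (hr : |r| ≤ 1) :
    |(∑ a ∈ s, ∑ b ∈ s, d a * d b * Real.exp (r * (a * b))) - (∑ a ∈ s, d a) ^ 2|
      ≤ |r| * ((∑ a ∈ s, ∑ b ∈ s, d a * d b * Real.exp (a * b)) - (∑ a ∈ s, d a) ^ 2) := by
  set m : ℕ → ℝ := fun k => ∑ a ∈ s, d a * a ^ k with hm
  have key : ∀ u : ℝ, HasSum (fun k : ℕ => u ^ (k + 1) * (m (k + 1) ^ 2 / ((k + 1).factorial : ℝ)))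
      ((∑ a ∈ s, ∑ b ∈ s, d a * d b * Real.exp (u * (a * b))) - (∑ a ∈ s, d a) ^ 2) := by
    intro u
    have h1 : HasSum (fun k : ℕ => u ^ k * (m k ^ 2 / (k.factorial : ℝ)))
        (∑ a ∈ s, ∑ b ∈ s, d a * d b * Real.exp (u * (a * b))) := by
      have h2 : HasSum (fun k : ℕ => ∑ a ∈ s, ∑ b ∈ s,
          d a * d b * ((u * (a * b)) ^ k / (k.factorial : ℝ)))
          (∑ a ∈ s, ∑ b ∈ s, d a * d b * Real.exp (u * (a * b))) := by
        refine hasSum_sum fun a _ => hasSum_sum fun b _ => HasSum.mul_left _ ?_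
        rw [Real.exp_eq_exp_ℝ]
        exact NormedSpace.expSeries_div_hasSum_exp (u * (a * b))
      convert h2 using 2 with k
      rw [hm]
      simp only
      rw [pow_two, Finset.sum_mul_sum, Finset.sum_div, Finset.mul_sum]
      refine Finset.sum_congr rfl fun a _ => ?_
      rw [Finset.sum_div, Finset.mul_sum]
      refine Finset.sum_congr rfl fun b _ => ?_
      rw [mul_pow, mul_pow]
      ring
    have h3 := (hasSum_nat_add_iff' 1).2 h1
    simpa [hm] using h3
  have hr1 := key r
  have h11 := (key 1)
  simp only [one_mul, one_pow] at h11
  have hR := h11.mul_left |r|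
  have hle : ∀ k : ℕ, |r ^ (k + 1) * (m (k + 1) ^ 2 / ((k + 1).factorial : ℝ))|
      ≤ |r| * (m (k + 1) ^ 2 / ((k + 1).factorial : ℝ)) := by
    intro k
    have hn : 0 ≤ m (k + 1) ^ 2 / ((k + 1).factorial : ℝ) := by positivity
    rw [abs_mul, abs_of_nonneg hn, abs_pow]
    refine mul_le_mul_of_nonneg_right ?_ hn
    rw [pow_succ]
    exact mul_le_of_le_one_left (abs_nonneg _) (pow_le_one₀ (abs_nonneg _) hr)
  rw [abs_le]
  constructor
  · have := hasSum_le (fun k => neg_le_of_abs_le (hle k)) hR.neg hr1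
    linarith
  · exact hasSum_le (fun k => le_of_abs_le (hle k)) hr1 hR

noncomputable abbrev γ : Measure ℝ := gaussianReal 0 1

lemma memLp_exp (t : ℝ) : MemLp (fun x : ℝ => Real.exp (t * x)) 2 γ := by
  rw [memLp_two_iff_integrable_sq (by fun_prop)]
  have := integrable_exp_mul_gaussianReal (μ := 0) (v := 1) (2 * t)
  refine this.congr (Filter.Eventually.of_forall fun x => ?_)
  simp only
  rw [pow_two, ← Real.exp_add]
  ring_nf

noncomputable def e (t : ℝ) : Lp ℝ 2 γ := (memLp_exp t).toLp _

lemma inner_toLp {α : Type*} [MeasurableSpace α] {μ : Measure α} {f g : α → ℝ}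
    (hf : MemLp f 2 μ) (hg : MemLp g 2 μ) :
    inner ℝ (hf.toLp f) (hg.toLp g) = ∫ x, f x * g x ∂μ := by
  rw [L2.inner_def]
  refine integral_congr_ae ?_
  filter_upwards [hf.coeFn_toLp, hg.coeFn_toLp] with x h1 h2
  rw [h1, h2]
  simp [mul_comm]

/-- A function orthogonal to all exponentials vanishes. -/
lemma ae_zero_of_orth (f : ℝ → ℝ) (hfm : Measurable f) (hf : MemLp f 2 γ)
    (ho : ∀ t : ℝ, ∫ x, Real.exp (t * x) * f x ∂γ = 0) : f =ᵐ[γ] 0 := by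
  have hint : ∀ t : ℝ, Integrable (fun x => Real.exp (t * x) * f x) γ := fun t =>
    (memLp_exp t).integrable_mul hf
  have hf1 : Integrable f γ := by simpa using hint 0
  have hmp : Measurable (fun x => ENNReal.ofReal (f x)) := by fun_prop
  have hmn : Measurable (fun x => ENNReal.ofReal (- f x)) := by fun_prop
  set P := γ.withDensity (fun x => ENNReal.ofReal (f x)) with hP
  set N := γ.withDensity (fun x => ENNReal.ofReal (- f x)) with hN
  have : IsFiniteMeasure P := isFiniteMeasure_withDensity_ofReal hf1.2
  have : IsFiniteMeasure N := isFiniteMeasure_withDensity_ofReal hf1.neg.2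
  have hip : ∀ t : ℝ, Integrable (fun x => Real.exp (t * x) * max (f x) 0) γ := by
    intro t
    refine (hint t).mono (by fun_prop) (Filter.Eventually.of_forall fun x => ?_)
    simp only [norm_mul]
    gcongr
    simp only [Real.norm_eq_abs]
    rw [abs_of_nonneg (le_max_right _ _)]
    exact max_le (le_abs_self _) (abs_nonneg _)
  have hin : ∀ t : ℝ, Integrable (fun x => Real.exp (t * x) * max (- f x) 0) γ := by
    intro t
    refine (hint t).mono (by fun_prop) (Filter.Eventually.of_forall fun x => ?_)
    simp only [norm_mul]
    gcongr
    simp only [Real.norm_eq_abs]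
    rw [abs_of_nonneg (le_max_right _ _)]
    exact max_le (neg_le_abs _) (abs_nonneg _)
  have hmgf : mgf id P = mgf id N := by
    ext t
    simp only [mgf, hP, hN, id]
    rw [integral_withDensity_eq_integral_toReal_smul hmp (by simp),
      integral_withDensity_eq_integral_toReal_smul hmn (by simp), ← sub_eq_zero]
    simp only [ENNReal.toReal_ofReal', smul_eq_mul]
    rw [← integral_sub (by simpa only [mul_comm] using hip t)
      (by simpa only [mul_comm] using hin t)]
    refine Eq.trans ?_ (ho t)
    refine integral_congr_ae (Filter.Eventually.of_forall fun x => ?_)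
    simp only
    rcases le_total (f x) 0 with h0 | h0
    · rw [max_eq_right h0, max_eq_left (by linarith)]; ring
    · rw [max_eq_left h0, max_eq_right (by linarith)]; ring
  have hexp : integrableExpSet id P = Set.univ := by
    ext t
    simp only [integrableExpSet, Set.mem_ofPred_eq, Set.mem_univ, iff_true, id, hP]
    rw [integrable_withDensity_iff hmp (by simp)]
    simpa only [ENNReal.toReal_ofReal'] using hip t
  have h00 : P = 0 ↔ N = 0 := by
    have := congrFun hmgf 0
    simp only [mgf_zero'] at this
    rw [← Measure.measure_univ_eq_zero, ← Measure.measure_univ_eq_zero (μ := N),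
      ← measureReal_eq_zero_iff, ← measureReal_eq_zero_iff, this]
  have hPN : P = N := by
    apply Measure.ext_of_complexMGF_id_eq
    have := eqOn_complexMGF_of_mgf' hmgf h00
    rw [hexp] at this
    ext z
    exact this (by simp)
  have := (withDensity_eq_iff_of_sigmaFinite hmp.aemeasurable hmn.aemeasurable).1 hPN
  filter_upwards [this] with x hx
  simp only [Pi.zero_apply]
  rcases lt_trichotomy (f x) 0 with h0 | h0 | h0
  · rw [ENNReal.ofReal_of_nonpos h0.le, eq_comm, ENNReal.ofReal_eq_zero] at hx; linarith
  · exact h0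
  · rw [ENNReal.ofReal_of_nonpos (p := - f x) (by linarith), ENNReal.ofReal_eq_zero] at hx
    linarith

lemma dense_span : Dense (Submodule.span ℝ (Set.range e) : Set (Lp ℝ 2 γ)) := by
  rw [Submodule.dense_iff_topologicalClosure_eq_top, Submodule.topologicalClosure_eq_top_iff,
    Submodule.eq_bot_iff]
  intro f hf
  rw [Submodule.mem_orthogonal] at hf
  have hfm : MemLp (f : ℝ → ℝ) 2 γ := Lp.memLp f
  have h0 := ae_zero_of_orth f (Lp.stronglyMeasurable f).measurable hfm (fun t => by
    have := hf (e t) (Submodule.subset_span ⟨t, rfl⟩)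
    rw [e, ← Lp.toLp_coeFn f (Lp.memLp f), inner_toLp] at this
    simpa using this)
  exact (Lp.eq_zero_iff_ae_eq_zero).2 h0

end Arcones

open Arcones in
/-- Arcones' inequality, Hermite rank ≥ 1, dimension 1: if `(W,Q)` is a centered Gaussian
vector with `E[W²] = E[Q²] = 1` and `r = E[WQ]`, and `h` satisfies `E[h(W)²] < ∞` and
`E[h(W)] = 0`, then `|E[h(W)h(Q)]| ≤ |r| E[h(W)²]`. -/
theorem arcones_inequality_rank_one {Ω : Type*} [MeasureSpace Ω]
    [IsProbabilityMeasure (ℙ : Measure Ω)]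
    (W Q : Ω → ℝ) (hWmeas : Measurable W) (hQmeas : Measurable Q)
    (hGauss : ∀ a b : ℝ, ∃ v : NNReal,
      Measure.map (fun ω => a * W ω + b * Q ω) ℙ = gaussianReal 0 v)
    (hW2 : ∫ ω, W ω ^ 2 ∂ℙ = 1) (hQ2 : ∫ ω, Q ω ^ 2 ∂ℙ = 1)
    (r : ℝ) (hr : r = ∫ ω, W ω * Q ω ∂ℙ)
    (h : ℝ → ℝ) (hmeas : Measurable h)
    (hL2 : Integrable (fun ω => h (W ω) ^ 2) ℙ)
    (hcentered : ∫ ω, h (W ω) ∂ℙ = 0) :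
    |∫ ω, h (W ω) * h (Q ω) ∂ℙ| ≤ |r| * ∫ ω, h (W ω) ^ 2 ∂ℙ := by
  have hsq : ∀ v : NNReal, ∫ x, x ^ 2 ∂(gaussianReal 0 v) = v := by
    intro v
    have := variance_fun_id_gaussianReal (μ := 0) (v := v)
    rw [variance_eq_integral measurable_id'.aemeasurable] at this
    simpa using this
  have hmap2 : ∀ (X : Ω → ℝ) (v : NNReal), Measurable X → Measure.map X ℙ = gaussianReal 0 v →
      ∫ ω, X ω ^ 2 ∂ℙ = v := by
    intro X v hX hv
    rw [← hsq v, ← hv, integral_map hX.aemeasurable (by fun_prop)]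
  have hmem : ∀ (X : Ω → ℝ) (v : NNReal), Measurable X → Measure.map X ℙ = gaussianReal 0 v →
      MemLp X 2 ℙ := by
    intro X v hX hv
    have h1 := memLp_id_gaussianReal' (μ := 0) (v := v) 2 (by simp)
    rw [← hv] at h1
    exact (memLp_map_measure_iff (by fun_prop) hX.aemeasurable).1 h1
  have hWg : Measure.map W ℙ = γ := by
    obtain ⟨v, hv⟩ := hGauss 1 0
    simp only [one_mul, zero_mul, add_zero] at hv
    have := hmap2 W v hWmeas hv
    rw [hW2] at this
    rw [hv, show v = 1 from by exact_mod_cast this.symm]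
  have hQg : Measure.map Q ℙ = γ := by
    obtain ⟨v, hv⟩ := hGauss 0 1
    simp only [one_mul, zero_mul, zero_add] at hv
    have := hmap2 Q v hQmeas hv
    rw [hQ2] at this
    rw [hv, show v = 1 from by exact_mod_cast this.symm]
  have hWL := hmem W 1 hWmeas hWg
  have hQL := hmem Q 1 hQmeas hQg
  have hWQ : Integrable (fun ω => W ω * Q ω) ℙ := hWL.integrable_mul hQL
  have hvar : ∀ a b : ℝ, ∫ ω, (a * W ω + b * Q ω) ^ 2 ∂ℙ = a ^ 2 + b ^ 2 + 2 * (r * (a * b)) := by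
    intro a b
    have : ∀ ω, (a * W ω + b * Q ω) ^ 2
        = a ^ 2 * W ω ^ 2 + b ^ 2 * Q ω ^ 2 + (2 * (a * b)) * (W ω * Q ω) := fun ω => by ring
    simp_rw [this]
    have i1 : Integrable (fun ω => a ^ 2 * W ω ^ 2) ℙ := hWL.integrable_sq.const_mul _
    have i2 : Integrable (fun ω => b ^ 2 * Q ω ^ 2) ℙ := hQL.integrable_sq.const_mul _
    rw [integral_add (f := fun ω => a ^ 2 * W ω ^ 2 + b ^ 2 * Q ω ^ 2) (i1.add i2)
      (hWQ.const_mul _), integral_add i1 i2,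
      integral_const_mul, integral_const_mul, integral_const_mul, hW2, hQ2, ← hr]
    ring
  have hr1 : |r| ≤ 1 := by
    rw [abs_le]
    have h1 := hvar 1 1
    have h2 := hvar 1 (-1)
    have p1 : 0 ≤ ∫ ω, (1 * W ω + 1 * Q ω) ^ 2 ∂ℙ := integral_nonneg fun ω => sq_nonneg _
    have p2 : 0 ≤ ∫ ω, (1 * W ω + (-1) * Q ω) ^ 2 ∂ℙ := integral_nonneg fun ω => sq_nonneg _
    constructor <;> linarith
  have hexp : ∀ a b : ℝ, ∫ ω, Real.exp (a * W ω) * Real.exp (b * Q ω) ∂ℙ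
      = Real.exp (a ^ 2 / 2) * Real.exp (b ^ 2 / 2) * Real.exp (r * (a * b)) := by
    intro a b
    obtain ⟨v, hv⟩ := hGauss a b
    have h1 := mgf_gaussianReal hv 1
    have h2 := hmap2 _ v (by fun_prop) hv
    rw [hvar] at h2
    simp only [mgf, one_mul] at h1
    simp_rw [← Real.exp_add]
    rw [h1, ← h2]
    ring_nf
  have hexpγ : ∀ t : ℝ, ∫ x, Real.exp (t * x) ∂γ = Real.exp (t ^ 2 / 2) := by
    intro t
    have h1 := mgf_gaussianReal (X := fun x : ℝ => x) (p := γ) (μ := 0) (v := 1) (by simp) t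
    simp only [mgf] at h1
    rw [h1]
    simp
  have mW : MeasurePreserving W ℙ γ := ⟨hWmeas, hWg⟩
  have mQ : MeasurePreserving Q ℙ γ := ⟨hQmeas, hQg⟩
  let A := Lp.compMeasurePreservingₗᵢ (E := ℝ) (p := 2) ℝ W mW
  let B := Lp.compMeasurePreservingₗᵢ (E := ℝ) (p := 2) ℝ Q mQ
  have hA : ∀ (f : ℝ → ℝ) (hf : MemLp f 2 γ), A (hf.toLp f)
      = (hf.comp_measurePreserving mW).toLp _ := fun f hf => rfl
  have hB : ∀ (f : ℝ → ℝ) (hf : MemLp f 2 γ), B (hf.toLp f)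
      = (hf.comp_measurePreserving mQ).toLp _ := fun f hf => rfl
  have iAB : ∀ a b : ℝ, inner ℝ (A (e a)) (B (e b))
      = Real.exp (a ^ 2 / 2) * Real.exp (b ^ 2 / 2) * Real.exp (r * (a * b)) := by
    intro a b
    rw [e, e, hA, hB, inner_toLp, ← hexp]
    rfl
  have iee : ∀ a b : ℝ, inner ℝ (e a) (e b)
      = Real.exp (a ^ 2 / 2) * Real.exp (b ^ 2 / 2) * Real.exp (a * b) := by
    intro a b
    rw [e, e, inner_toLp]
    simp_rw [← Real.exp_add, ← add_mul]
    rw [hexpγ]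
    ring_nf
  have ie0 : ∀ a : ℝ, inner ℝ (e a) (e 0) = Real.exp (a ^ 2 / 2) := by
    intro a
    rw [iee]; simp
  have main : ∀ f : Lp ℝ 2 γ, |inner ℝ (A f) (B f) - inner ℝ f (e 0) ^ 2|
      ≤ |r| * (inner ℝ f f - inner ℝ f (e 0) ^ 2) := by
    have hclosed : IsClosed {f : Lp ℝ 2 γ | |inner ℝ (A f) (B f) - inner ℝ f (e 0) ^ 2|
      ≤ |r| * (inner ℝ f f - inner ℝ f (e 0) ^ 2)} := by
      have cA : Continuous A := A.continuous
      have cB : Continuous B := B.continuous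
      apply isClosed_le
      · exact ((cA.inner cB).sub ((continuous_id.inner continuous_const).pow 2)).abs
      · exact continuous_const.mul ((continuous_id.inner continuous_id).sub
          ((continuous_id.inner continuous_const).pow 2))
    have hsub : (Submodule.span ℝ (Set.range e) : Set (Lp ℝ 2 γ)) ⊆
        {f : Lp ℝ 2 γ | |inner ℝ (A f) (B f) - inner ℝ f (e 0) ^ 2|
      ≤ |r| * (inner ℝ f f - inner ℝ f (e 0) ^ 2)} := by
      intro f hf
      obtain ⟨c, rfl⟩ := Finsupp.mem_span_range_iff_exists_finsupp.1 hf
      have := core c.support (fun a => c a * Real.exp (a ^ 2 / 2)) r hr1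
      simp only [Set.mem_ofPred_eq, Finsupp.sum, map_sum, map_smul, sum_inner, inner_sum,
        inner_smul_left, inner_smul_right, iAB, iee, ie0, conj_trivial]
      convert this using 4
      · rw [Finset.mul_sum]
        refine Finset.sum_congr rfl fun b _ => ?_
        ring_nf
      · simp
      · rw [Finset.mul_sum]
        refine Finset.sum_congr rfl fun b _ => ?_
        ring_nf
      · simp
    intro f
    have := closure_minimal hsub hclosed
    rw [dense_span.closure_eq] at this
    exact this (Set.mem_univ f)
  have hhL : MemLp h 2 γ := by
    rw [← hWg, memLp_map_measure_iff (by fun_prop) hWmeas.aemeasurable,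
      memLp_two_iff_integrable_sq (hmeas.comp hWmeas).aestronglyMeasurable]
    exact hL2
  have fin := main (hhL.toLp h)
  have z : inner ℝ (hhL.toLp h) (e 0) = 0 := by
    rw [e, inner_toLp, ← hWg, integral_map hWmeas.aemeasurable (by fun_prop)]
    simpa using hcentered
  rw [z, hA, hB, inner_toLp, inner_toLp, ← hWg,
    integral_map hWmeas.aemeasurable (by fun_prop)] at fin
  simpa [pow_two] using fin
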